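/- (Estimating γ.) Let T be a measurable space, μ a probability measure on T, m ≥ 2, δ > 0, η ∈ (0,1), and w : T × {1,…,m} → [0,1] measurable. Let R and R' be two independent profiles of km i.i.d. draws from μ, and for the profile R' let v̂(R') be the matrix of empirical means of N i.i.d. samples per entry from distributions on [0,1] with means w(R'_i, j) (all samples independent). If N ≥ 2·log(4 m² k/η)/(δ² (log m)²) and k ≥ 32·log(8/η)/(δ²·m·(log m)²), then γ := (4/k)·OPT_δ(v̂(R')) satisfies OPT_δ(V(R))/k ≤ γ ≤ 12·OPT_δ(V(R))/k with probability at least 1 − η. -/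

import Mathlib

open MeasureTheory
open scoped ENNReal

/-- The entropy-regularized matching value `OPT_δ(v)`: the supremum over fractional `k`-to-`1`
assignments `x ≥ 0` (row sums at most `1` over the `km` replicas, column sums at most `k` over
the `m` surrogates) of `∑_{i,j} x_{ij} v_{ij} - δ ∑_{i,j} x_{ij} log x_{ij}`.  The convention
`0·log 0 = 0` holds automatically since `Real.log 0 = 0`. -/
noncomputable def OPTreg (m k : ℕ) (δ : ℝ) (v : Fin (k * m) → Fin m → ℝ) : ℝ :=
  sSup {val : ℝ | ∃ x : Fin (k * m) → Fin m → ℝ,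
    (∀ i j, 0 ≤ x i j) ∧ (∀ i, ∑ j, x i j ≤ 1) ∧ (∀ j, ∑ i, x i j ≤ (k : ℝ)) ∧
    val = ∑ i, ∑ j, (x i j * v i j - δ * (x i j * Real.log (x i j)))}

open ProbabilityTheory

/-- A bounded measurable function on a finite power of a probability space, which changes by at
most `c` when one coordinate is changed, has a sub-Gaussian moment generating function. -/
theorem integral_exp_mul_le_of_bounded_differences {T : Type*} [MeasurableSpace T]
    (μ : Measure T) [IsProbabilityMeasure μ] {c : ℝ} (hc : 0 ≤ c) (t : ℝ) :
    ∀ (n : ℕ) (f : (Fin n → T) → ℝ), Measurable f → (∃ C, ∀ x, |f x| ≤ C) →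
      (∀ i x y, (∀ j, j ≠ i → x j = y j) → |f x - f y| ≤ c) →
      ∫ x, Real.exp (t * f x) ∂(Measure.pi fun _ : Fin n => μ) ≤
        Real.exp (t * ∫ x, f x ∂(Measure.pi fun _ : Fin n => μ) + n * (c / 2) ^ 2 * t ^ 2 / 2) := by
  intro n
  induction n with
  | zero =>
    intro f _ _ _
    have h : ∀ x, f x = f default := fun x => by rw [Subsingleton.elim x default]
    simp_rw [h]
    simp
  | succ n ih =>
    rintro f hf ⟨C, hC⟩ hd
    set P := Measure.pi fun _ : Fin n => μ
    let e := MeasurableEquiv.piFinSuccAbove (fun _ : Fin (n + 1) => T) 0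
    have he : MeasurePreserving e.symm (μ.prod P) (Measure.pi fun _ : Fin (n + 1) => μ) :=
      (measurePreserving_piFinSuccAbove (fun _ : Fin (n + 1) => μ) 0).symm
    have hF : Measurable fun p => f (e.symm p) := hf.comp e.symm.measurable
    have hFs : ∀ s, Measurable fun r => f (e.symm (s, r)) := fun s =>
      hF.comp measurable_prodMk_left
    have hFi : Integrable (fun p => f (e.symm p)) (μ.prod P) :=
      Integrable.of_bound hF.aestronglyMeasurable C (.of_forall fun p => hC _)
    have hFsi : ∀ s, Integrable (fun r => f (e.symm (s, r))) P := fun s =>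
      Integrable.of_bound (hFs s).aestronglyMeasurable C (.of_forall fun p => hC _)
    have hexp : ∀ x, |Real.exp (t * f x)| ≤ Real.exp (|t| * C) := fun x => by
      rw [abs_of_pos (Real.exp_pos _)]
      apply Real.exp_le_exp.2
      calc t * f x ≤ |t * f x| := le_abs_self _
        _ = |t| * |f x| := abs_mul _ _
        _ ≤ |t| * C := by gcongr; exact hC x
    have hEi : Integrable (fun p => Real.exp (t * f (e.symm p))) (μ.prod P) :=
      Integrable.of_bound (hF.const_mul t).exp.aestronglyMeasurable (Real.exp (|t| * C))
        (.of_forall fun p => hexp _)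
    set h : T → ℝ := fun s => ∫ r, f (e.symm (s, r)) ∂P with hh
    have hhm : Measurable h := hF.stronglyMeasurable.integral_prod_right'.measurable
    have hhd : ∀ s s', |h s - h s'| ≤ c := by
      intro s s'
      simp only [hh]
      rw [← integral_sub (hFsi s) (hFsi s')]
      have := norm_integral_le_of_norm_le_const (μ := P) (C := c)
        (f := fun r => f (e.symm (s, r)) - f (e.symm (s', r))) (.of_forall fun r => ?_)
      · simpa using this
      · refine hd 0 _ _ fun j hj => ?_
        obtain ⟨j, rfl⟩ := Fin.exists_succ_eq.2 hj
        simp [e, MeasurableEquiv.piFinSuccAbove, Fin.insertNthEquiv]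
    have hinner : ∀ s, ∫ r, Real.exp (t * f (e.symm (s, r))) ∂P ≤
        Real.exp (t * h s + n * (c / 2) ^ 2 * t ^ 2 / 2) := by
      intro s
      refine ih (fun r => f (e.symm (s, r))) (hFs s) ⟨C, fun r => hC _⟩ fun i x y hxy => ?_
      refine hd i.succ _ _ fun j hj => ?_
      refine Fin.cases ?_ (fun j hj => ?_) j hj
      · intro _
        simp [e, MeasurableEquiv.piFinSuccAbove, Fin.insertNthEquiv]
      · simpa [e, MeasurableEquiv.piFinSuccAbove, Fin.insertNthEquiv] using
          hxy j fun h => hj (by rw [h])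
    have : Nonempty T := by
      by_contra hT
      rw [not_nonempty_iff] at hT
      exact IsProbabilityMeasure.ne_zero μ (Measure.eq_zero_of_isEmpty μ)
    have hbdd : BddBelow (Set.range h) := by
      obtain ⟨s₀⟩ := this
      refine ⟨h s₀ - c, ?_⟩
      rintro _ ⟨s, rfl⟩
      linarith [abs_le.1 (hhd s s₀)]
    have hmem : ∀ s, h s ∈ Set.Icc (⨅ s, h s) ((⨅ s, h s) + c) := fun s => by
      refine ⟨ciInf_le hbdd s, ?_⟩
      have : h s - c ≤ ⨅ s, h s := le_ciInf fun s' => by linarith [(abs_le.1 (hhd s s')).2]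
      linarith
    have hsub := hasSubgaussianMGF_of_mem_Icc (μ := μ) hhm.aemeasurable (.of_forall hmem)
    have hmgf := hsub.mgf_le t
    have hei := hsub.integrable_exp_mul t
    have hfac : ∀ s, Real.exp (t * h s + n * (c / 2) ^ 2 * t ^ 2 / 2) =
        Real.exp (t * (h s - ∫ s, h s ∂μ)) *
          Real.exp (t * (∫ s, h s ∂μ) + n * (c / 2) ^ 2 * t ^ 2 / 2) := fun s => by
      rw [← Real.exp_add]; ring_nf
    rw [← he.integral_comp', ← he.integral_comp', integral_prod _ hEi, integral_prod _ hFi]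
    calc ∫ s, ∫ r, Real.exp (t * f (e.symm (s, r))) ∂P ∂μ
        ≤ ∫ s, Real.exp (t * h s + n * (c / 2) ^ 2 * t ^ 2 / 2) ∂μ := by
          refine integral_mono hEi.integral_prod_left ?_ hinner
          simp_rw [hfac]
          exact hei.mul_const _
      _ = mgf (fun s => h s - ∫ s, h s ∂μ) μ t *
          Real.exp (t * (∫ s, h s ∂μ) + n * (c / 2) ^ 2 * t ^ 2 / 2) := by
          simp_rw [hfac]
          rw [integral_mul_const]; rfl
      _ ≤ _ := by
          grw [hmgf]
          rw [← Real.exp_add]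
          apply le_of_eq
          simp only [add_sub_cancel_left, NNReal.coe_pow, NNReal.coe_div, coe_nnnorm,
            Real.norm_eq_abs, abs_of_nonneg hc, NNReal.coe_ofNat]
          push_cast
          congr 1
          ring

/-- **McDiarmid's inequality**, one-sided form. -/
theorem measureReal_ge_le_of_bounded_differences {T : Type*} [MeasurableSpace T]
    (μ : Measure T) [IsProbabilityMeasure μ] {c : ℝ} (hc : 0 ≤ c) {n : ℕ} {f : (Fin n → T) → ℝ}
    (hf : Measurable f) (hb : ∃ C, ∀ x, |f x| ≤ C)
    (hd : ∀ i x y, (∀ j, j ≠ i → x j = y j) → |f x - f y| ≤ c) {ε : ℝ} (hε : 0 ≤ ε) :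
    (Measure.pi fun _ : Fin n => μ).real
        {x | ε ≤ f x - ∫ y, f y ∂(Measure.pi fun _ : Fin n => μ)} ≤
      Real.exp (-ε ^ 2 / (2 * (n * (c / 2) ^ 2))) := by
  obtain ⟨C, hC⟩ := hb
  set P := Measure.pi fun _ : Fin n => μ
  have hsub : HasSubgaussianMGF (fun x => f x - ∫ y, f y ∂P) (n * (c.toNNReal / 2) ^ 2) P := by
    constructor
    · intro t
      refine integrable_exp_mul_of_mem_Icc (a := -C - ∫ y, f y ∂P) (b := C - ∫ y, f y ∂P)
        (hf.sub_const _).aemeasurable (.of_forall fun x => ?_)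
      have := abs_le.1 (hC x)
      constructor <;> linarith
    · intro t
      have h := integral_exp_mul_le_of_bounded_differences μ hc t n f hf ⟨C, hC⟩ hd
      have : mgf (fun x => f x - ∫ y, f y ∂P) P t =
          (∫ x, Real.exp (t * f x) ∂P) * Real.exp (- (t * ∫ y, f y ∂P)) := by
        rw [mgf, ← integral_mul_const]
        congr 1; ext x
        rw [← Real.exp_add]; ring_nf
      rw [this]
      grw [h]
      rw [← Real.exp_add]
      apply le_of_eq
      simp only [NNReal.coe_mul, NNReal.coe_natCast, NNReal.coe_pow, NNReal.coe_div,
        Real.coe_toNNReal _ hc, NNReal.coe_ofNat]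
      congr 1
      ring
  simpa [Real.coe_toNNReal _ hc] using hsub.measure_ge_le hε

/-- **McDiarmid's inequality**, two-sided form. -/
theorem measureReal_abs_ge_le_of_bounded_differences {T : Type*} [MeasurableSpace T]
    (μ : Measure T) [IsProbabilityMeasure μ] {c : ℝ} (hc : 0 ≤ c) {n : ℕ} {f : (Fin n → T) → ℝ}
    (hf : Measurable f) (hb : ∃ C, ∀ x, |f x| ≤ C)
    (hd : ∀ i x y, (∀ j, j ≠ i → x j = y j) → |f x - f y| ≤ c) {ε : ℝ} (hε : 0 ≤ ε) :
    (Measure.pi fun _ : Fin n => μ).real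
        {x | ε ≤ |f x - ∫ y, f y ∂(Measure.pi fun _ : Fin n => μ)|} ≤
      2 * Real.exp (-ε ^ 2 / (2 * (n * (c / 2) ^ 2))) := by
  have h1 := measureReal_ge_le_of_bounded_differences μ hc hf hb hd hε
  have h2 := measureReal_ge_le_of_bounded_differences μ hc hf.neg (by simpa using hb)
    (fun i x y h => by simpa [neg_add_eq_sub, abs_sub_comm] using hd i x y h) hε
  have hsub : {x | ε ≤ |f x - ∫ y, f y ∂(Measure.pi fun _ : Fin n => μ)|} ⊆
      {x | ε ≤ f x - ∫ y, f y ∂(Measure.pi fun _ : Fin n => μ)} ∪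
        {x | ε ≤ (-f) x - ∫ y, (-f) y ∂(Measure.pi fun _ : Fin n => μ)} := by
    intro x hx
    rw [Set.mem_ofPred_eq] at hx
    rcases le_abs.1 hx with h | h
    · exact Or.inl h
    · right
      change ε ≤ -f x - ∫ y, -f y ∂(Measure.pi fun _ : Fin n => μ)
      rw [integral_neg]
      linarith
  grw [measureReal_mono hsub, measureReal_union_le, h1, h2, two_mul (Real.exp _)]

/-- **Hoeffding's inequality**, two-sided, for the empirical mean of a bounded function of
distinct coordinates of an i.i.d. family. -/
theorem measureReal_abs_empirical_mean_sub_ge_le {ι : Type*} [Fintype ι]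
    (ν : Measure ℝ) [IsProbabilityMeasure ν] {N : ℕ} (hN : 0 < N) (s : Fin N → ι)
    (hs : Function.Injective s) {g : ℝ → ℝ} (hg : Measurable g)
    (hgr : ∀ᵐ u ∂ν, g u ∈ Set.Icc (0 : ℝ) 1) {ε : ℝ} (hε : 0 ≤ ε) :
    (Measure.pi fun _ : ι => ν).real {u | ε ≤ |(∑ n, g (u (s n))) / N - ∫ x, g x ∂ν|} ≤
      2 * Real.exp (-(2 * N * ε ^ 2)) := by
  set P := Measure.pi fun _ : ι => ν
  set a := ∫ x, g x ∂ν
  have hN' : (0 : ℝ) < N := by exact_mod_cast hN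
  have hsub : ∀ i, HasSubgaussianMGF (fun u : ι → ℝ => g (u i) - a) ((‖(1:ℝ) - 0‖₊ / 2) ^ 2) P := by
    intro i
    have hp : MeasurePreserving (Function.eval i) P ν := measurePreserving_eval _ i
    have h := hasSubgaussianMGF_of_mem_Icc hg.aemeasurable hgr
    rw [← hp.map_eq] at h
    have := h.of_map (Y := Function.eval i) hp.measurable.aemeasurable
    rw [hp.map_eq] at this
    exact this
  have hind : iIndepFun (fun n (u : ι → ℝ) => g (u (s n)) - a) P :=
    (iIndepFun_pi (μ := fun _ : ι => ν) (X := fun _ x => g x - a)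
      fun i => (hg.sub_const a).aemeasurable).precomp hs
  have hind' : iIndepFun (fun n (u : ι → ℝ) => -(g (u (s n)) - a)) P :=
    (iIndepFun_pi (μ := fun _ : ι => ν) (X := fun _ x => -(g x - a))
      fun i => (hg.sub_const a).neg.aemeasurable).precomp hs
  have h1 := HasSubgaussianMGF.measure_sum_ge_le_of_iIndepFun hind (s := Finset.univ)
    (fun n _ => hsub (s n)) (ε := N * ε) (by positivity)
  have h2 := HasSubgaussianMGF.measure_sum_ge_le_of_iIndepFun hind' (s := Finset.univ)
    (fun n _ => (hsub (s n)).neg) (ε := N * ε) (by positivity)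
  have hexp : -(N * ε) ^ 2 / (2 * ((∑ _i : Fin N, (‖(1:ℝ) - 0‖₊ / 2) ^ 2 : NNReal) : ℝ)) =
      -(2 * N * ε ^ 2) := by
    simp
    field_simp
  push_cast at hexp h1 h2
  rw [hexp] at h1 h2
  have hsubset : {u : ι → ℝ | ε ≤ |(∑ n, g (u (s n))) / N - a|} ⊆
      {u | N * ε ≤ ∑ n, (g (u (s n)) - a)} ∪ {u | N * ε ≤ ∑ n, -(g (u (s n)) - a)} := by
    intro u hu
    have hsum : ∑ n, (g (u (s n)) - a) = N * ((∑ n, g (u (s n))) / N - a) := by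
      rw [Finset.sum_sub_distrib]
      simp
      field_simp
    rw [Set.mem_ofPred_eq] at hu
    rcases le_abs.1 hu with h | h
    · left
      change N * ε ≤ ∑ n, (g (u (s n)) - a)
      rw [hsum]
      gcongr
    · right
      change N * ε ≤ ∑ n, -(g (u (s n)) - a)
      rw [Finset.sum_neg_distrib, hsum, ← mul_neg]
      gcongr
  grw [measureReal_mono hsubset, measureReal_union_le, h1, h2, two_mul (Real.exp _)]

/-- The values of feasible fractional assignments are bounded above. -/
theorem OPTreg_bddAbove (m k : ℕ) {δ : ℝ} (hδ : 0 ≤ δ) (v : Fin (k * m) → Fin m → ℝ) :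
    BddAbove {val : ℝ | ∃ x : Fin (k * m) → Fin m → ℝ,
      (∀ i j, 0 ≤ x i j) ∧ (∀ i, ∑ j, x i j ≤ 1) ∧ (∀ j, ∑ i, x i j ≤ (k : ℝ)) ∧
      val = ∑ i, ∑ j, (x i j * v i j - δ * (x i j * Real.log (x i j)))} := by
  refine ⟨∑ i, ∑ j, (|v i j| + δ), ?_⟩
  rintro _ ⟨x, hx0, hx1, -, rfl⟩
  gcongr with i _ j _
  have hx : x i j ≤ 1 :=
    (Finset.single_le_sum (fun j _ => hx0 i j) (Finset.mem_univ j)).trans (hx1 i)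
  have h1 : x i j * v i j ≤ |v i j| := by
    calc x i j * v i j ≤ x i j * |v i j| := by gcongr; exacts [hx0 i j, le_abs_self _]
      _ ≤ 1 * |v i j| := by gcongr
      _ = |v i j| := one_mul _
  have h2 : -(x i j * Real.log (x i j)) ≤ 1 := by
    rcases (hx0 i j).eq_or_lt with h | h
    · simp [← h]
    · have := mul_le_mul_of_nonneg_left (Real.one_sub_inv_le_log_of_pos h) h.le
      rw [mul_sub, mul_inv_cancel₀ h.ne'] at this
      linarith
  nlinarith

/-- If the weights of row `i` change by at most `d i`, the regularized matching value changes by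
at most `∑ i, d i`. -/
theorem OPTreg_le_add_sum (m k : ℕ) {δ : ℝ} (hδ : 0 ≤ δ) {v v' : Fin (k * m) → Fin m → ℝ}
    {d : Fin (k * m) → ℝ} (hd : ∀ i, 0 ≤ d i) (h : ∀ i j, v i j ≤ v' i j + d i) :
    OPTreg m k δ v ≤ OPTreg m k δ v' + ∑ i, d i := by
  refine csSup_le ⟨_, 0, by simp, by simp, by simp, rfl⟩ ?_
  rintro _ ⟨x, hx0, hx1, hx2, rfl⟩
  have hle : ∑ i, ∑ j, (x i j * v' i j - δ * (x i j * Real.log (x i j))) ≤ OPTreg m k δ v' :=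
    le_csSup (OPTreg_bddAbove m k hδ v') ⟨x, hx0, hx1, hx2, rfl⟩
  grw [← hle]
  rw [← Finset.sum_add_distrib]
  gcongr with i _
  calc ∑ j, (x i j * v i j - δ * (x i j * Real.log (x i j)))
      ≤ ∑ j, ((x i j * v' i j - δ * (x i j * Real.log (x i j))) + x i j * d i) := by
        gcongr with j _
        nlinarith [mul_le_mul_of_nonneg_left (h i j) (hx0 i j)]
    _ ≤ _ := by
        rw [Finset.sum_add_distrib, ← Finset.sum_mul]
        gcongr
        nlinarith [hd i, hx1 i]

/-- Two-sided form of `OPTreg_le_add_sum`. -/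
theorem abs_OPTreg_sub_le_sum (m k : ℕ) {δ : ℝ} (hδ : 0 ≤ δ) {v v' : Fin (k * m) → Fin m → ℝ}
    {d : Fin (k * m) → ℝ} (hd : ∀ i, 0 ≤ d i) (h : ∀ i j, |v i j - v' i j| ≤ d i) :
    |OPTreg m k δ v - OPTreg m k δ v'| ≤ ∑ i, d i := by
  rw [abs_sub_le_iff]
  constructor
  · linarith [OPTreg_le_add_sum m k hδ hd (v := v) (v' := v')
      fun i j => by linarith [(abs_le.1 (h i j)).2]]
  · linarith [OPTreg_le_add_sum m k hδ hd (v := v') (v' := v)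
      fun i j => by linarith [(abs_le.1 (h i j)).1]]

/-- The regularized matching value is `km`-Lipschitz for the uniform distance on weights. -/
theorem abs_OPTreg_sub_le_mul (m k : ℕ) {δ : ℝ} (hδ : 0 ≤ δ) {v v' : Fin (k * m) → Fin m → ℝ}
    {ε : ℝ} (hε : 0 ≤ ε) (h : ∀ i j, |v i j - v' i j| ≤ ε) :
    |OPTreg m k δ v - OPTreg m k δ v'| ≤ k * m * ε := by
  simpa using abs_OPTreg_sub_le_sum m k hδ (fun _ => hε) h

/-- The regularized matching value is continuous in the weights. -/
theorem continuous_OPTreg (m k : ℕ) {δ : ℝ} (hδ : 0 ≤ δ) : Continuous (OPTreg m k δ) := by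
  refine (LipschitzWith.of_dist_le_mul (K := (k * m : ℕ)) fun v v' => ?_).continuous
  rw [Real.dist_eq]
  have := abs_OPTreg_sub_le_mul m k hδ (v := v) (v' := v') (dist_nonneg (x := v) (y := v'))
    fun i j => by
      rw [← Real.dist_eq]
      exact (dist_le_pi_dist (v i) (v' i) j).trans (dist_le_pi_dist v v' i)
  simpa using this

/-- The uniform assignment gives a lower bound for the regularized matching value of
nonnegative weights. -/
theorem le_OPTreg {m : ℕ} (k : ℕ) (hm : 0 < m) {δ : ℝ} (hδ : 0 ≤ δ)
    {v : Fin (k * m) → Fin m → ℝ} (hv : ∀ i j, 0 ≤ v i j) :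
    δ * (k * m * Real.log m) ≤ OPTreg m k δ v := by
  have hm' : (0 : ℝ) < m := by exact_mod_cast hm
  refine le_trans ?_ (le_csSup (OPTreg_bddAbove m k hδ v)
    ⟨fun _ _ => (m : ℝ)⁻¹, fun _ _ => by positivity, fun i => ?_, fun j => ?_, rfl⟩)
  · calc δ * (k * m * Real.log m)
        = ∑ i : Fin (k * m), ∑ j : Fin m,
            (0 - δ * ((m : ℝ)⁻¹ * Real.log (m : ℝ)⁻¹)) := by
          simp [Real.log_inv]
          field_simp
      _ ≤ _ := by
          gcongr with i _ j _
          have := hv i j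
          positivity
  · simp [hm'.ne']
  · simp [hm'.ne']

/-- Concentration of the regularized matching value of a random replica profile. -/
theorem measureReal_OPTreg_sub_integral_ge_le {T : Type*} [MeasurableSpace T] (μ : Measure T)
    [IsProbabilityMeasure μ] {m k : ℕ} {δ ε : ℝ} (hδ : 0 ≤ δ) (hε : 0 ≤ ε)
    {w : T → Fin m → ℝ} (hw : ∀ j, Measurable fun t => w t j)
    (hwr : ∀ t j, w t j ∈ Set.Icc (0 : ℝ) 1) :
    (Measure.pi fun _ : Fin (k * m) => μ).real
        {R | ε ≤ |OPTreg m k δ (fun i j => w (R i) j) -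
          ∫ R, OPTreg m k δ (fun i j => w (R i) j) ∂(Measure.pi fun _ : Fin (k * m) => μ)|} ≤
      2 * Real.exp (-(2 * ε ^ 2 / (k * m))) := by
  have hdist : ∀ s t j, |w s j - w t j| ≤ 1 := fun s t j => by
    rw [abs_le]
    have hs := hwr s j
    have ht := hwr t j
    constructor <;> linarith [hs.1, hs.2, ht.1, ht.2]
  refine (measureReal_abs_ge_le_of_bounded_differences μ zero_le_one
    (f := fun R => OPTreg m k δ fun i j => w (R i) j) ?_ ?_ ?_ hε).trans_eq ?_
  · exact (continuous_OPTreg m k hδ).measurable.comp (measurable_pi_lambda _ fun i =>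
      measurable_pi_lambda _ fun j => (hw j).comp (measurable_pi_apply i))
  · refine ⟨|OPTreg m k δ 0| + k * m * 1, fun R => ?_⟩
    have h := abs_OPTreg_sub_le_mul m k hδ (v := fun i j => w (R i) j) (v' := 0) zero_le_one
      fun i j => by simpa [abs_of_nonneg (hwr (R i) j).1] using (hwr (R i) j).2
    linarith [abs_sub_abs_le_abs_sub (OPTreg m k δ fun i j => w (R i) j) (OPTreg m k δ 0)]
  · intro i x y hxy
    refine (abs_OPTreg_sub_le_sum m k hδ (d := fun i' => if i' = i then 1 else 0)
      (fun i' => by positivity) fun i' j => ?_).trans_eq (by simp)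
    split_ifs with h
    · exact hdist _ _ _
    · simp [hxy i' h]
  · congr 2
    push_cast
    rw [neg_div, neg_inj, show (2 : ℝ) * (k * m * (1 / 2) ^ 2) = k * m / 2 by ring,
      div_div_eq_mul_div]
    ring

/-- Uniform deviation bound for the empirical weight estimates of a fixed replica profile. -/
theorem measureReal_exists_empirical_mean_sub_ge_le {T : Type*} [MeasurableSpace T]
    (ν : Measure ℝ) [IsProbabilityMeasure ν] {ι κ : Type*} [Fintype ι] [Fintype κ]
    {N : ℕ} (hN : 0 < N) {w : T → κ → ℝ} {g : T → κ → ℝ → ℝ}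
    (hg : ∀ j, Measurable fun p : T × ℝ => g p.1 j p.2)
    (hgr : ∀ t j, ∀ᵐ u ∂ν, g t j u ∈ Set.Icc (0 : ℝ) 1)
    (hgm : ∀ t j, ∫ u, g t j u ∂ν = w t j) {ε : ℝ} (hε : 0 ≤ ε) (R : ι → T) :
    (Measure.pi fun _ : ι × κ × Fin N => ν).real
        {u | ∃ i j, ε ≤ |(∑ n, g (R i) j (u (i, j, n))) / N - w (R i) j|} ≤
      Fintype.card ι * Fintype.card κ * (2 * Real.exp (-(2 * N * ε ^ 2))) := by
  simp only [Set.ofPred_exists]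
  calc _ ≤ ∑ i : ι, ∑ j : κ, (Measure.pi fun _ : ι × κ × Fin N => ν).real
          {u | ε ≤ |(∑ n, g (R i) j (u (i, j, n))) / N - w (R i) j|} := by
        refine (measureReal_iUnion_fintype_le _).trans ?_
        gcongr with i
        exact measureReal_iUnion_fintype_le _
    _ ≤ ∑ _i : ι, ∑ _j : κ, 2 * Real.exp (-(2 * N * ε ^ 2)) := by
        gcongr with i _ j _
        rw [← hgm (R i) j]
        exact measureReal_abs_empirical_mean_sub_ge_le ν hN (fun n => (i, j, n))
          (fun a b h => by simpa using h) ((hg j).comp measurable_prodMk_left) (hgr _ _) hε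
    _ = _ := by simp [mul_assoc]

/-- **Estimating `γ`.** Let `R` and `R'` be two independent profiles of `km` i.i.d. draws from
`μ`.  For the profile `R'`, each edge `(i,j)` gets `N` i.i.d. samples from a distribution on
`[0,1]` with mean `w(R'_i, j)`; these samples are realized as `g (R'_i) j u` where the noise
variables `u` are i.i.d. with law `ν` (independent of everything else, and independent across
edges and samples), `g` takes values in `[0,1]` `ν`-a.s., and `∫ g t j u ∂ν = w t j`.  Let
`v̂(R')_{ij}` be the empirical mean of these `N` samples.  If
`N ≥ 2·log(4m²k/η)/(δ²(log m)²)` and `k ≥ 32·log(8/η)/(δ²·m·(log m)²)`, then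
`γ := (4/k)·OPT_δ(v̂(R'))` satisfies `OPT_δ(V(R))/k ≤ γ ≤ 12·OPT_δ(V(R))/k` with probability
at least `1 - η`, where `V(R)_{ij} = w(R_i, j)`. -/
theorem gamma_estimate
    {T : Type*} [MeasurableSpace T] (μ : Measure T) [IsProbabilityMeasure μ]
    (m k N : ℕ) (hm : 2 ≤ m) (hk : 1 ≤ k) (hN : 0 < N)
    (δ η : ℝ) (hδ : 0 < δ) (hη : η ∈ Set.Ioo (0 : ℝ) 1)
    (w : T → Fin m → ℝ) (hw : ∀ j, Measurable fun t => w t j)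
    (hwr : ∀ t j, w t j ∈ Set.Icc (0 : ℝ) 1)
    (ν : Measure ℝ) [IsProbabilityMeasure ν]
    (g : T → Fin m → ℝ → ℝ)
    (hg : ∀ j, Measurable fun p : T × ℝ => g p.1 j p.2)
    (hgr : ∀ t j, ∀ᵐ u ∂ν, g t j u ∈ Set.Icc (0 : ℝ) 1)
    (hgm : ∀ t j, ∫ u, g t j u ∂ν = w t j)
    (hNbig : (N : ℝ) ≥ 2 * Real.log (4 * m ^ 2 * k / η) / (δ ^ 2 * (Real.log m) ^ 2))
    (hkbig : (k : ℝ) ≥ 32 * Real.log (8 / η) / (δ ^ 2 * m * (Real.log m) ^ 2)) :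
    (((Measure.pi fun _ : Fin (k * m) => μ).prod (Measure.pi fun _ : Fin (k * m) => μ)).prod
        (Measure.pi fun _ : Fin (k * m) × Fin m × Fin N => ν))
      {ω | OPTreg m k δ (fun i j => w (ω.1.1 i) j) / k
            ≤ (4 / k) * OPTreg m k δ (fun i j => (∑ n, g (ω.1.2 i) j (ω.2 (i, j, n))) / N)
         ∧ (4 / k) * OPTreg m k δ (fun i j => (∑ n, g (ω.1.2 i) j (ω.2 (i, j, n))) / N)
            ≤ 12 * OPTreg m k δ (fun i j => w (ω.1.1 i) j) / k}
      ≥ 1 - ENNReal.ofReal η := by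
  obtain ⟨hη0, hη1⟩ := hη
  have hm0 : (0 : ℝ) < m := by positivity
  have hk0 : (0 : ℝ) < k := by positivity
  have hL : 0 < Real.log m := Real.log_pos (by exact_mod_cast hm)
  set P := Measure.pi fun _ : Fin (k * m) => μ
  set Q := Measure.pi fun _ : Fin (k * m) × Fin m × Fin N => ν
  set B : ℝ := k * m * (δ * Real.log m) with hB
  have hB0 : 0 < B := by positivity
  have hfB : ∀ R : Fin (k * m) → T, B ≤ OPTreg m k δ fun i j => w (R i) j := fun R =>
    calc B = δ * (k * m * Real.log m) := by ring
      _ ≤ _ := le_OPTreg k (by omega) hδ.le fun i j => (hwr _ _).1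
  set E := ∫ R, OPTreg m k δ (fun i j => w (R i) j) ∂P
  set bad₁ := {R : Fin (k * m) → T | B / 4 ≤ |OPTreg m k δ (fun i j => w (R i) j) - E|} with hbad₁
  set bad₂ := {ω : ((Fin (k * m) → T) × (Fin (k * m) → T)) × (Fin (k * m) × Fin m × Fin N → ℝ) |
    ∃ i j, δ * Real.log m / 2 ≤
      |(∑ n, g (ω.1.2 i) j (ω.2 (i, j, n))) / N - w (ω.1.2 i) j|} with hbad₂
  have hprofile : P bad₁ ≤ ENNReal.ofReal (η / 4) := by
    rw [← ofReal_measureReal]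
    gcongr
    refine (measureReal_OPTreg_sub_integral_ge_le μ hδ.le (by positivity) hw hwr).trans ?_
    have h : 32 * Real.log (8 / η) ≤ k * (δ ^ 2 * m * Real.log m ^ 2) :=
      (div_le_iff₀ (by positivity)).1 hkbig
    have h8 : 0 ≤ Real.log (8 / η) := Real.log_nonneg (by rw [le_div_iff₀ hη0]; linarith)
    calc 2 * Real.exp (-(2 * (B / 4) ^ 2 / (k * m)))
        = 2 * Real.exp (-(k * (δ ^ 2 * m * Real.log m ^ 2) / 8)) := by
          rw [hB]; congr 3; field_simp; norm_num
      _ ≤ 2 * Real.exp (-Real.log (8 / η)) := by gcongr; linarith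
      _ = η / 4 := by
          rw [Real.exp_neg, Real.exp_log (by positivity)]; field_simp; norm_num
  have hnoise : ∀ R : (Fin (k * m) → T) × (Fin (k * m) → T),
      Q (Prod.mk R ⁻¹' bad₂) ≤ ENNReal.ofReal (η / 2) := by
    intro R
    rw [← ofReal_measureReal]
    gcongr
    refine (measureReal_exists_empirical_mean_sub_ge_le ν hN hg hgr hgm (by positivity) R.2).trans ?_
    have h : 2 * Real.log (4 * m ^ 2 * k / η) ≤ N * (δ ^ 2 * Real.log m ^ 2) :=
      (div_le_iff₀ (by positivity)).1 hNbig
    simp only [Fintype.card_fin]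
    calc ((k * m : ℕ) : ℝ) * m * (2 * Real.exp (-(2 * N * (δ * Real.log m / 2) ^ 2)))
        ≤ ((k * m : ℕ) : ℝ) * m * (2 * Real.exp (-Real.log (4 * m ^ 2 * k / η))) := by
          gcongr; linarith
      _ = η / 2 := by
          rw [Real.exp_neg, Real.exp_log (by positivity)]
          push_cast
          field_simp
          norm_num
  have hmeas : MeasurableSet bad₂ := by
    simp only [hbad₂, Set.ofPred_exists]
    refine .iUnion fun i => .iUnion fun j => measurableSet_le measurable_const ?_
    have hRi : Measurable fun ω : ((Fin (k * m) → T) × (Fin (k * m) → T)) ×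
        (Fin (k * m) × Fin m × Fin N → ℝ) => ω.1.2 i :=
      (measurable_pi_apply i).comp (measurable_snd.comp measurable_fst)
    have hsum := Finset.measurable_sum Finset.univ fun (n : Fin N) _ =>
      (hg j).comp (hRi.prodMk ((measurable_pi_apply (i, j, n)).comp measurable_snd))
    exact ((hsum.div_const _).sub ((hw j).comp hRi)).abs
  have hbad₂_le : ((P.prod P).prod Q) bad₂ ≤ ENNReal.ofReal (η / 2) := by
    rw [Measure.prod_apply hmeas]
    exact (lintegral_mono hnoise).trans (by simp)
  have hfst : ((P.prod P).prod Q) {ω | ω.1.1 ∈ bad₁} ≤ ENNReal.ofReal (η / 4) := by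
    have : {ω : ((Fin (k * m) → T) × (Fin (k * m) → T)) × (Fin (k * m) × Fin m × Fin N → ℝ) |
        ω.1.1 ∈ bad₁} = (bad₁ ×ˢ Set.univ) ×ˢ Set.univ := by
      ext; simp
    rw [this, Measure.prod_prod, Measure.prod_prod]
    simpa using hprofile
  have hsnd : ((P.prod P).prod Q) {ω | ω.1.2 ∈ bad₁} ≤ ENNReal.ofReal (η / 4) := by
    have : {ω : ((Fin (k * m) → T) × (Fin (k * m) → T)) × (Fin (k * m) × Fin m × Fin N → ℝ) |
        ω.1.2 ∈ bad₁} = (Set.univ ×ˢ bad₁) ×ˢ Set.univ := by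
      ext; simp
    rw [this, Measure.prod_prod, Measure.prod_prod]
    simpa using hprofile
  set good := {ω : ((Fin (k * m) → T) × (Fin (k * m) → T)) × (Fin (k * m) × Fin m × Fin N → ℝ) |
    OPTreg m k δ (fun i j => w (ω.1.1 i) j) / k
      ≤ (4 / k) * OPTreg m k δ (fun i j => (∑ n, g (ω.1.2 i) j (ω.2 (i, j, n))) / N)
    ∧ (4 / k) * OPTreg m k δ (fun i j => (∑ n, g (ω.1.2 i) j (ω.2 (i, j, n))) / N)
      ≤ 12 * OPTreg m k δ (fun i j => w (ω.1.1 i) j) / k} with hgood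
  have hcover : Set.univ ⊆ good ∪ ({ω | ω.1.1 ∈ bad₁} ∪ {ω | ω.1.2 ∈ bad₁} ∪ bad₂) := by
    intro ω _
    by_contra hω
    simp only [hgood, hbad₁, hbad₂, Set.mem_union, Set.mem_ofPred_eq, not_or, not_exists,
      not_le] at hω
    obtain ⟨hng, ⟨h1, h2⟩, h3⟩ := hω
    apply hng
    have h4 := abs_OPTreg_sub_le_mul m k hδ.le (v' := fun i j => w (ω.1.2 i) j) (by positivity)
      fun i j => (h3 i j).le
    have h5 := hfB ω.1.1
    have h6 := hfB ω.1.2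
    have hmid : (k : ℝ) * m * (δ * Real.log m / 2) = B / 2 := by rw [hB]; ring
    rw [hmid] at h4
    rw [abs_lt] at h1 h2
    rw [abs_le] at h4
    rw [div_mul_eq_mul_div]
    constructor <;> refine div_le_div_of_nonneg_right ?_ hk0.le <;> linarith
  have htotal := (measure_mono (μ := (P.prod P).prod Q) hcover).trans (measure_union_le _ _)
  have hsum : ((P.prod P).prod Q) ({ω | ω.1.1 ∈ bad₁} ∪ {ω | ω.1.2 ∈ bad₁} ∪ bad₂) ≤
      ENNReal.ofReal η := by
    grw [measure_union_le, measure_union_le, hfst, hsnd, hbad₂_le]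
    rw [← ENNReal.ofReal_add (by positivity) (by positivity),
      ← ENNReal.ofReal_add (by positivity) (by positivity)]
    exact le_of_eq (by ring_nf)
  rw [measure_univ] at htotal
  rw [ge_iff_le, tsub_le_iff_right]
  exact htotal.trans (by gcongr)
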